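/- For every real u > 1, (1/2)·∫_{t ∈ (u,∞)} (log(t−1)/t − log(t)/(t−1)) dt + π²/10 = Li2((u−1)/u) + (1/2)·log((u−1)/u)·log(1/u) − π²/15, where Li2(x) = Σ_{k=1}^{∞} x^k/k² (the series converges since 0 < (u−1)/u < 1). -/

import Mathlib

open MeasureTheory

/-- The version of Rogers' dilogarithm used in the paper:
`R(u) = (1/2)·∫_{u}^{∞} (log(t−1)/t − log t/(t−1)) dt + π²/10` for `u > 1`. -/
noncomputable def RogersR (u : ℝ) : ℝ :=
  (1 / 2) * (∫ t in Set.Ioi u, (Real.log (t - 1) / t - Real.log t / (t - 1))) +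
    Real.pi ^ 2 / 10

/-- The classical dilogarithm `Li₂(x) = Σ_{k=1}^{∞} x^k / k²`. -/
noncomputable def Li2 (x : ℝ) : ℝ := ∑' k : ℕ, x ^ (k + 1) / ((k : ℝ) + 1) ^ 2

lemma summable_sq_aux : Summable (fun k : ℕ => 1 / ((k : ℝ) + 1) ^ 2) := by
  have := (summable_nat_add_iff 1).mpr hasSum_zeta_two.summable
  simpa using this

lemma Li2_one : Li2 1 = Real.pi ^ 2 / 6 := by
  have := (hasSum_nat_add_iff' 1).mpr hasSum_zeta_two
  unfold Li2
  have h := this.tsum_eq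
  simpa using h

lemma Li2_cont : ContinuousOn Li2 (Set.Icc 0 1) := by
  unfold Li2
  refine continuousOn_tsum (u := fun k : ℕ => 1 / ((k : ℝ) + 1) ^ 2) ?_ summable_sq_aux ?_
  · intro i
    fun_prop
  · intro n x hx
    rw [Real.norm_of_nonneg (by have := hx.1; positivity)]
    gcongr
    exact pow_le_one₀ hx.1 hx.2

lemma Li2_deriv (x : ℝ) (h0 : 0 < x) (h1 : x < 1) :
    HasDerivAt Li2 (-Real.log (1 - x) / x) x := by
  have hs : ∑' n : ℕ, x ^ n / ((n : ℝ) + 1) = -Real.log (1 - x) / x := by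
    have := (Real.hasSum_pow_div_log_of_abs_lt_one (x := x) (by rw [abs_of_pos h0]; exact h1))
    have h2 := (this.div_const x).tsum_eq
    rw [← h2]
    congr 1
    ext n
    rw [pow_succ]
    field_simp
  rw [← hs]
  unfold Li2
  refine hasDerivAt_tsum_of_isPreconnected (t := Set.Ioo (-((x + 1) / 2)) ((x + 1) / 2))
    (u := fun n => ((x + 1) / 2) ^ n) (y₀ := 0)
    (g' := fun (n : ℕ) (y : ℝ) => y ^ n / ((n : ℝ) + 1))
    (summable_geometric_of_lt_one (by linarith) (by linarith)) isOpen_Ioo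
    isPreconnected_Ioo ?_ ?_ ?_ ?_ ?_
  · intro n y _
    have := (hasDerivAt_pow (n + 1) y).div_const (((n : ℝ) + 1) ^ 2)
    refine this.congr_deriv ?_
    have : (n : ℝ) + 1 ≠ 0 := by positivity
    simp only [Nat.add_sub_cancel]
    push_cast
    field_simp
  · intro n y hy
    rw [norm_div, norm_pow, Real.norm_eq_abs, Real.norm_eq_abs,
      abs_of_pos (by positivity : (0 : ℝ) < (n : ℝ) + 1)]
    have h3 : |y| ≤ (x + 1) / 2 := abs_le.mpr ⟨hy.1.le, hy.2.le⟩
    calc |y| ^ n / ((n : ℝ) + 1) ≤ |y| ^ n := div_le_self (by positivity) (by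
          have : (0 : ℝ) ≤ n := by positivity
          linarith)
      _ ≤ _ := by gcongr
  · constructor <;> linarith
  · simp
  · constructor <;> linarith

lemma logprod_tendsto : Filter.Tendsto
    (fun t : ℝ => Real.log ((t - 1) / t) * Real.log (1 / t)) Filter.atTop (nhds 0) := by
  have hl : Filter.Tendsto (fun t : ℝ => 2 * (Real.log t / t)) Filter.atTop (nhds 0) := by
    have := (Real.isLittleO_log_id_atTop.tendsto_div_nhds_zero).const_mul 2
    simpa using this
  refine tendsto_of_tendsto_of_tendsto_of_le_of_le' tendsto_const_nhds hl ?_ ?_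
  · filter_upwards [Filter.eventually_ge_atTop 2] with t ht
    apply mul_nonneg_of_nonpos_of_nonpos
    · exact Real.log_nonpos (div_nonneg (by linarith) (by linarith))
        ((div_le_one (by linarith)).mpr (by linarith))
    · exact Real.log_nonpos (by positivity) ((div_le_one (by linarith)).mpr (by linarith))
  · filter_upwards [Filter.eventually_ge_atTop 2] with t ht
    have hlog : 0 ≤ Real.log t := Real.log_nonneg (by linarith)
    have h1 : -Real.log ((t - 1) / t) ≤ 2 / t := by
      rw [← Real.log_inv, inv_div]
      have := Real.log_le_sub_one_of_pos (x := t / (t - 1)) (div_pos (by linarith) (by linarith))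
      refine this.trans ?_
      rw [div_sub_one (by linarith), div_le_div_iff₀ (by linarith) (by linarith)]
      linarith
    have h2 : Real.log (1 / t) = -Real.log t := by rw [one_div, Real.log_inv]
    rw [h2]
    calc _ = (-Real.log ((t - 1) / t)) * Real.log t := by ring
      _ ≤ 2 / t * Real.log t := by gcongr
      _ = _ := by ring

lemma x_tendsto : Filter.Tendsto (fun t : ℝ => (t - 1) / t) Filter.atTop (nhds 1) := by
  have h : Filter.Tendsto (fun t : ℝ => 1 - t⁻¹) Filter.atTop (nhds (1 - 0)) :=
    tendsto_const_nhds.sub tendsto_inv_atTop_zero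
  rw [sub_zero] at h
  refine h.congr' ?_
  filter_upwards [Filter.eventually_gt_atTop 0] with t ht
  field_simp

/-- for `u > 1`,
`R(u) = Li₂((u−1)/u) + (1/2)·log((u−1)/u)·log(1/u) − π²/15`. -/
theorem stmt8 (u : ℝ) (hu : 1 < u) :
    RogersR u = Li2 ((u - 1) / u)
      + (1 / 2) * Real.log ((u - 1) / u) * Real.log (1 / u) - Real.pi ^ 2 / 15 := by
  have key := integral_Ioi_of_hasDerivAt_of_nonpos' (a := u)
    (g := fun t => -2 * Li2 ((t - 1) / t) - Real.log ((t - 1) / t) * Real.log (1 / t))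
    (g' := fun t => Real.log (t - 1) / t - Real.log t / (t - 1))
    (l := -2 * (Real.pi ^ 2 / 6) - 0) ?_ ?_ ?_
  · unfold RogersR
    rw [key]
    ring
  · intro t ht
    have ht1 : 1 < t := lt_of_lt_of_le hu ht
    have ht0 : t ≠ 0 := by linarith
    have ht2 : t - 1 ≠ 0 := by linarith
    have hx0 : 0 < (t - 1) / t := div_pos (by linarith) (by linarith)
    have hx1 : (t - 1) / t < 1 := (div_lt_one (by linarith)).mpr (by linarith)
    have hx : HasDerivAt (fun t : ℝ => (t - 1) / t) (1 / t ^ 2) t := by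
      refine (((hasDerivAt_id t).sub_const 1).div (hasDerivAt_id t) ht0).congr_deriv ?_
      simp
    have hi : HasDerivAt (fun t : ℝ => 1 / t) (-1 / t ^ 2) t := by
      refine ((hasDerivAt_const t (1 : ℝ)).div (hasDerivAt_id t) ht0).congr_deriv ?_
      simp
    have hL := HasDerivAt.comp (h := fun t : ℝ => (t - 1) / t) t (Li2_deriv _ hx0 hx1) hx
    have h := (hL.const_mul (-2)).sub ((hx.log hx0.ne').mul (hi.log (one_div_ne_zero ht0)))
    refine h.congr_deriv ?_
    have e1 : 1 - (t - 1) / t = 1 / t := by field_simp; ring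
    rw [e1, Real.log_div ht2 ht0, one_div, Real.log_inv]
    field_simp
    ring
  · intro t ht
    have ht1 : 1 < t := lt_trans hu ht
    have h1 : Real.log (t - 1) ≤ Real.log t := Real.log_le_log (by linarith) (by linarith)
    have h2 : 0 ≤ Real.log t := Real.log_nonneg ht1.le
    have h3 : Real.log (t - 1) / t ≤ Real.log t / t := by gcongr
    have h4 : Real.log t / t ≤ Real.log t / (t - 1) :=
      div_le_div_of_nonneg_left h2 (by linarith) (by linarith)
    linarith
  · refine Filter.Tendsto.sub (Filter.Tendsto.const_mul _ ?_) logprod_tendsto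
    rw [← Li2_one]
    refine (Li2_cont 1 (by simp)).tendsto.comp (tendsto_nhdsWithin_iff.mpr ⟨x_tendsto, ?_⟩)
    filter_upwards [Filter.eventually_gt_atTop 1] with t ht
    exact ⟨div_nonneg (by linarith) (by linarith), (div_le_one (by linarith)).mpr (by linarith)⟩
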